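/- arXiv:1911.12232 — 2 statements merged into one kernel-verified Lean document; each statement's English description precedes it below -/
import Mathlib

section
/- Let G be a finite group and let 𝒳 be a partition of Irr(G). Define the equivalence relation ~ on G by u ~ v if and only if σ_X(u) = σ_X(v) for every part X ∈ 𝒳, and let 𝒦 denote the set of equivalence classes of ~ (each of which is a union of conjugacy classes of G, regarded as a subset of Con(G)). If the number of equivalence classes |𝒦| equals |𝒳|, then (𝒳, 𝒦) is a supercharacter theory of G. -/
open scoped BigOperators

/-- `σ_X(g) = ∑_{χ ∈ X} χ(1)·χ(g)`. -/
noncomputable def sigmaCF {G : Type} [Group G] (X : Set (G → ℂ)) (g : G) : ℂ :=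
  ∑ᶠ χ ∈ X, χ 1 * χ g

/-- `f` is the character of some irreducible (simple) complex representation of `G`. -/
def IsIrrChar (G : Type) [Group G] (f : G → ℂ) : Prop :=
  ∃ V : FDRep ℂ G, CategoryTheory.Simple V ∧ FDRep.character V = f

/-- The set of irreducible complex characters of `G`. -/
def Irr (G : Type) [Group G] : Set (G → ℂ) := {f | IsIrrChar G f}

/-- The trivial character of `G`. -/
def trivChar (G : Type) [Group G] : G → ℂ := fun _ => 1

/-- `X ⊆ Irr(G)` and `S ⊆ Con(G)` are consistent if `σ_X` takes the same value on all
conjugacy classes belonging to `S`. -/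
def Consistent {G : Type} [Group G] (X : Set (G → ℂ)) (S : Set (ConjClasses G)) : Prop :=
  ∀ x y : G, ConjClasses.mk x ∈ S → ConjClasses.mk y ∈ S → sigmaCF X x = sigmaCF X y

/-- `X` is a bad part: every nonempty subset of `Con(G)` consistent with `X` is a singleton. -/
def IsBadPart {G : Type} [Group G] (X : Set (G → ℂ)) : Prop :=
  ∀ S : Set (ConjClasses G), S.Nonempty → Consistent X S → ∃ K, S = {K}

/-- A supercharacter theory of `G`: `𝒳` is a partition of `Irr(G)`, `𝒦` is a partition of
`Con(G)` containing `{e}` as a part, `|𝒳| = |𝒦|`, and every part of `𝒳` is consistent with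
every part of `𝒦`. -/
structure IsSCT (G : Type) [Group G] (𝒳 : Set (Set (G → ℂ)))
    (𝒦 : Set (Set (ConjClasses G))) : Prop where
  nonemptyX : ∀ X ∈ 𝒳, X.Nonempty
  pairwiseX : 𝒳.Pairwise Disjoint
  unionX : ⋃₀ 𝒳 = Irr G
  nonemptyK : ∀ S ∈ 𝒦, S.Nonempty
  pairwiseK : 𝒦.Pairwise Disjoint
  unionK : ⋃₀ 𝒦 = Set.univ
  idClassMem : {ConjClasses.mk (1 : G)} ∈ 𝒦
  cardEq : 𝒳.ncard = 𝒦.ncard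
  consistentPairs : ∀ X ∈ 𝒳, ∀ S ∈ 𝒦, Consistent X S

/-- A set partition of a type `α`. -/
def IsSetPartition {α : Type} (P : Set (Set α)) : Prop :=
  (∀ A ∈ P, A.Nonempty) ∧ P.Pairwise Disjoint ∧ ⋃₀ P = Set.univ

/-- The `n`-th Bell number: the number of set partitions of an `n`-element set. -/
noncomputable def bell (n : ℕ) : ℕ :=
  Nat.card {P : Set (Set (Fin n)) // IsSetPartition P}

open CategoryTheory in
theorem irr_of_irreducible {G : Type} [Group G] [Finite G] {V : Type} [AddCommGroup V] [Module ℂ V]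
    [FiniteDimensional ℂ V] (ρ : Representation ℂ G V) [ρ.IsIrreducible] :
    ρ.character ∈ Irr G := by
  classical
  have := Fintype.ofFinite G
  have hc : (Nat.card G : ℂ) ≠ 0 := by exact_mod_cast Nat.card_pos.ne'
  let : Invertible (Nat.card G : ℂ) := invertibleOfNonzero hc
  have : NeZero (Nat.card G : ℂ) := ⟨hc⟩
  refine ⟨FDRep.of ρ, ?_, rfl⟩
  rw [FDRep.simple_iff_char_is_norm_one]
  have h := Representation.char_orthonormal ρ ρ
  rw [if_pos ⟨Representation.Equiv.refl ρ⟩] at h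
  change ∑ g : G, ρ.character g * ρ.character g⁻¹ = _
  field_simp at h
  exact h

theorem trace_add_of_isCompl {V : Type} [AddCommGroup V] [Module ℂ V]
    [FiniteDimensional ℂ V] (p q : Submodule ℂ V) (h : IsCompl p q) (f : V →ₗ[ℂ] V)
    (hp : ∀ x ∈ p, f x ∈ p) (hq : ∀ x ∈ q, f x ∈ q) :
    LinearMap.trace ℂ V f = LinearMap.trace ℂ p (f.restrict hp) +
      LinearMap.trace ℂ q (f.restrict hq) := by
  rw [← LinearMap.trace_prodMap',
    ← LinearMap.trace_conj' _ (Submodule.prodEquivOfIsCompl p q h)]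
  congr 1
  ext x
  obtain ⟨y, rfl⟩ := (Submodule.prodEquivOfIsCompl p q h).surjective x
  simp [LinearEquiv.conj_apply]

theorem char_mem_span {G : Type} [Group G] [Finite G] (n : ℕ) :
    ∀ (V : Type) [AddCommGroup V] [Module ℂ V] [FiniteDimensional ℂ V]
      (ρ : Representation ℂ G V), Module.finrank ℂ V = n →
      ρ.character ∈ Submodule.span ℂ (Irr G) := by
  induction n using Nat.strong_induction_on with
  | _ n ih =>
  intro V _ _ _ ρ hn
  by_cases hirr : ρ.IsIrreducible
  · exact Submodule.subset_span (irr_of_irreducible ρ)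
  rcases subsingleton_or_nontrivial V with hV | hV
  · have : ρ.character = 0 := by
      ext g
      have : ρ g = 0 := Subsingleton.elim _ _
      simp [Representation.character, this]
    rw [this]; exact Submodule.zero_mem _
  have hc : (Nat.card G : ℂ) ≠ 0 := by exact_mod_cast Nat.card_pos.ne'
  have : NeZero (Nat.card G : ℂ) := ⟨hc⟩
  have hss : ρ.IsSemisimpleRepresentation := by
    rw [Representation.isSemisimpleRepresentation_iff_isSemisimpleModule_asModule]
    infer_instance
  have hnt : Nontrivial (Subrepresentation ρ) := by
    refine ⟨⊥, ⊤, fun h => ?_⟩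
    have := congrArg Subrepresentation.toSubmodule h
    exact bot_ne_top (α := Submodule ℂ V) this
  obtain ⟨N, hN0, hN1⟩ : ∃ N : Subrepresentation ρ, N ≠ ⊥ ∧ N ≠ ⊤ := by
    by_contra! hcon
    exact hirr ⟨fun N => or_iff_not_imp_left.2 (hcon N)⟩
  obtain ⟨N', hN'⟩ := exists_isCompl N
  have hcompl : IsCompl N.toSubmodule N'.toSubmodule := by
    constructor
    · rw [disjoint_iff]
      exact congrArg Subrepresentation.toSubmodule hN'.inf_eq_bot
    · rw [codisjoint_iff]
      exact congrArg Subrepresentation.toSubmodule hN'.sup_eq_top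
  have hlt : ∀ M : Subrepresentation ρ, M ≠ ⊤ → Module.finrank ℂ M.toSubmodule < n := by
    intro M hM
    rw [← hn]
    apply Submodule.finrank_lt
    intro h
    exact hM (Subrepresentation.toSubmodule_injective h)
  have hN'1 : N' ≠ ⊤ := by
    rintro rfl
    exact hN0 (by simpa using hN'.inf_eq_bot)
  have : ρ.character = N.toRepresentation.character + N'.toRepresentation.character := by
    ext g
    exact trace_add_of_isCompl _ _ hcompl (ρ g) (N.apply_mem_toSubmodule g) (N'.apply_mem_toSubmodule g)
  rw [this]
  exact Submodule.add_mem _ (ih _ (hlt N hN1) _ _ rfl) (ih _ (hlt N' hN'1) _ _ rfl)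

/-- Pairing against `g ↦ χ (g⁻¹)`. -/
noncomputable def pairL {G : Type} [Group G] [Fintype G] (χ : G → ℂ) : (G → ℂ) →ₗ[ℂ] ℂ where
  toFun f := (Nat.card G : ℂ)⁻¹ * ∑ g : G, f g * χ g⁻¹
  map_add' f f' := by simp [add_mul, Finset.sum_add_distrib, mul_add]
  map_smul' c f := by
    simp only [Pi.smul_apply, smul_eq_mul, RingHom.id_apply, mul_assoc, ← Finset.mul_sum]
    ring

open CategoryTheory in
theorem pairL_irr {G : Type} [Group G] [Fintype G] {χ ψ : G → ℂ} (hχ : χ ∈ Irr G)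
    (hψ : ψ ∈ Irr G) [Decidable (ψ = χ)] : pairL χ ψ = if ψ = χ then 1 else 0 := by
  classical
  obtain ⟨V, hV, rfl⟩ := hχ
  obtain ⟨W, hW, rfl⟩ := hψ
  have hc : (Nat.card G : ℂ) ≠ 0 := by exact_mod_cast Nat.card_pos.ne'
  let : Invertible (Nat.card G : ℂ) := invertibleOfNonzero hc
  have key := FDRep.char_orthonormal W V
  change (Nat.card G : ℂ)⁻¹ * ∑ g : G, W.character g * V.character g⁻¹ = _
  split_ifs with h
  · rw [h]
    have := FDRep.char_orthonormal V V
    rwa [if_pos ⟨Iso.refl V⟩] at this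
  · rw [key, if_neg]
    rintro ⟨i⟩
    exact h (FDRep.char_iso i)

theorem irr_finite (G : Type) [Group G] [Finite G] : (Irr G).Finite := by
  classical
  have := Fintype.ofFinite G
  have h : LinearIndependent ℂ (Subtype.val : Irr G → (G → ℂ)) := by
    rw [linearIndependent_iff']
    intro s c hs i hi
    have h2 := congrArg (pairL i.1) hs
    rw [map_sum, map_zero] at h2
    simp only [map_smul, pairL_irr i.2 (Subtype.prop _), smul_eq_mul, Subtype.val_inj] at h2
    simpa [hi] using h2
  exact h.setFinite

theorem expand_of_span {G : Type} [Group G] [Fintype G] {f : G → ℂ}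
    (hf : f ∈ Submodule.span ℂ (Irr G)) :
    f = ∑ χ ∈ (irr_finite G).toFinset, pairL χ f • χ := by
  classical
  induction hf using Submodule.span_induction with
  | mem ψ hψ =>
    rw [Finset.sum_eq_single ψ]
    · rw [pairL_irr hψ hψ]; simp
    · intro χ hχ hne
      rw [pairL_irr ((irr_finite G).mem_toFinset.1 hχ) hψ, if_neg (Ne.symm hne), zero_smul]
    · intro h
      exact absurd ((irr_finite G).mem_toFinset.2 hψ) h
  | zero => simp
  | add x y _ _ hx hy =>
    conv_lhs => rw [hx, hy]
    simp [add_smul, Finset.sum_add_distrib]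
  | smul c x _ hx =>
    conv_lhs => rw [hx]
    simp [Finset.smul_sum, smul_smul]

/-- The right regular representation on functions. -/
noncomputable def regRep (G : Type) [Group G] : Representation ℂ G (G → ℂ) where
  toFun g := LinearMap.funLeft ℂ ℂ (fun h => h * g)
  map_one' := by ext; simp [LinearMap.funLeft_apply]
  map_mul' a b := by ext; simp [LinearMap.funLeft_apply, mul_assoc]

open Classical in
theorem regRep_char {G : Type} [Group G] [Fintype G] (g : G) :
    (regRep G).character g = if g = 1 then (Nat.card G : ℂ) else 0 := by
  rw [Representation.character, LinearMap.trace_eq_matrix_trace ℂ (Pi.basisFun ℂ G)]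
  simp only [Matrix.trace, Matrix.diag, LinearMap.toMatrix_apply, regRep]
  simp only [MonoidHom.coe_mk, OneHom.coe_mk, Pi.basisFun_apply, Pi.basisFun_repr,
    LinearMap.funLeft_apply, Pi.single_apply, mul_eq_left]
  split_ifs <;> simp

theorem sigma_irr {G : Type} [Group G] [Finite G] (g : G) (hg : g ≠ 1) :
    sigmaCF (Irr G) g ≠ sigmaCF (Irr G) 1 := by
  classical
  have := Fintype.ofFinite G
  have hc : (Nat.card G : ℂ) ≠ 0 := by exact_mod_cast Nat.card_pos.ne'
  have h := expand_of_span (char_mem_span (G := G) _ _ (regRep G) rfl)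
  have hp : ∀ χ : G → ℂ, pairL χ (regRep G).character = χ 1 := by
    intro χ
    change (Nat.card G : ℂ)⁻¹ * ∑ g : G, (regRep G).character g * χ g⁻¹ = _
    simp only [regRep_char, ite_mul, zero_mul, Finset.sum_ite_eq', Finset.mem_univ, if_true,
      inv_one]
    field_simp
  have hs : ∀ x : G, sigmaCF (Irr G) x = (regRep G).character x := by
    intro x
    rw [h, sigmaCF, finsum_mem_eq_finite_toFinset_sum _ (irr_finite G)]
    simp [hp]
  rw [hs, hs, regRep_char, regRep_char, if_neg hg, if_pos rfl]
  exact hc.symm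

theorem sigma_conj {G : Type} [Group G] {X : Set (G → ℂ)} (hX : X ⊆ Irr G) {x y : G}
    (h : ConjClasses.mk x = ConjClasses.mk y) : sigmaCF X x = sigmaCF X y := by
  rw [ConjClasses.mk_eq_mk_iff_isConj, isConj_iff] at h
  obtain ⟨c, rfl⟩ := h
  unfold sigmaCF
  refine finsum_mem_congr rfl fun χ hχ => ?_
  obtain ⟨V, _, rfl⟩ := hX hχ
  rw [FDRep.char_conj]

/-- if `𝒳` is a partition of `Irr(G)` and `𝒦` is the set of equivalence classes
(regarded as subsets of `Con(G)`) of the relation `u ~ v ↔ ∀ X ∈ 𝒳, σ_X(u) = σ_X(v)`, and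
`|𝒦| = |𝒳|`, then `(𝒳, 𝒦)` is a supercharacter theory of `G`. -/
theorem stmt_2 {G : Type} [Group G] [Finite G]
    (𝒳 : Set (Set (G → ℂ)))
    (hne : ∀ X ∈ 𝒳, X.Nonempty) (hpw : 𝒳.Pairwise Disjoint) (hun : ⋃₀ 𝒳 = Irr G)
    (𝒦 : Set (Set (ConjClasses G)))
    (h𝒦 : 𝒦 = {S : Set (ConjClasses G) | ∃ g : G,
      S = {K : ConjClasses G | ∃ x : G, ConjClasses.mk x = K ∧
            ∀ X ∈ 𝒳, sigmaCF X x = sigmaCF X g}})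
    (hcard : 𝒦.ncard = 𝒳.ncard) :
    IsSCT G 𝒳 𝒦 := by
  have hsub : ∀ X ∈ 𝒳, X ⊆ Irr G := fun X hX => hun ▸ Set.subset_sUnion_of_mem hX
  have hfin : 𝒳.Finite := (irr_finite G).finite_subsets.subset hsub
  subst h𝒦
  refine ⟨hne, hpw, hun, ?_, ?_, ?_, ?_, hcard.symm, ?_⟩
  · rintro S ⟨g, rfl⟩
    exact ⟨ConjClasses.mk g, g, rfl, fun _ _ => rfl⟩
  · rintro S ⟨g, rfl⟩ T ⟨g', rfl⟩ hST
    rw [Set.disjoint_left]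
    rintro K ⟨x, rfl, hx⟩ ⟨y, hy, hy'⟩
    apply hST
    have hgg : ∀ X ∈ 𝒳, sigmaCF X g = sigmaCF X g' := fun X hX => by
      rw [← hx X hX, ← hy' X hX, sigma_conj (hsub X hX) hy]
    ext K
    constructor
    · rintro ⟨z, hz, h⟩
      exact ⟨z, hz, fun X hX => (h X hX).trans (hgg X hX)⟩
    · rintro ⟨z, hz, h⟩
      exact ⟨z, hz, fun X hX => (h X hX).trans (hgg X hX).symm⟩
  · rw [Set.eq_univ_iff_forall]
    intro K
    obtain ⟨g, rfl⟩ := ConjClasses.exists_rep K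
    exact ⟨_, ⟨g, rfl⟩, g, rfl, fun _ _ => rfl⟩
  · refine ⟨1, ?_⟩
    ext K
    constructor
    · rintro rfl
      exact ⟨1, rfl, fun _ _ => rfl⟩
    · rintro ⟨x, rfl, hx⟩
      by_cases h1 : x = 1
      · rw [h1]; rfl
      exfalso
      apply sigma_irr x h1
      have hsum : ∀ y : G, sigmaCF (Irr G) y = ∑ᶠ X ∈ 𝒳, sigmaCF X y := by
        intro y
        rw [← hun]
        unfold sigmaCF
        exact finsum_mem_sUnion hpw hfin fun X hX => (irr_finite G).subset (hsub X hX)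
      rw [hsum, hsum]
      exact finsum_mem_congr rfl hx
  · rintro X hX S ⟨g, rfl⟩ x y ⟨x', hx, hx'⟩ ⟨y', hy, hy'⟩
    rw [← sigma_conj (hsub X hX) hx, ← sigma_conj (hsub X hX) hy, hx' X hX, hy' X hX]
end

section
/- The cyclic group Z₇ of order 7 has exactly four supercharacter theories: the two trivial supercharacter theories m(Z₇) and M(Z₇), one theory whose nontrivial parts (of both characters and classes) all have size 3, and one theory whose nontrivial parts all have size 2. -/
open scoped BigOperators

/-- The cyclic group of order 7, written multiplicatively. -/
abbrev Z7 : Type := Multiplicative (ZMod 7)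

/-- The character partition of the trivial supercharacter theory `m(Z₇)`. -/
def mX : Set (Set (Z7 → ℂ)) := {S | ∃ f ∈ Irr Z7, S = {f}}

/-- The class partition of the trivial supercharacter theory `m(Z₇)`. -/
def mK : Set (Set (ConjClasses Z7)) := {T | ∃ K : ConjClasses Z7, T = {K}}

/-- The character partition of the trivial supercharacter theory `M(Z₇)`. -/
def MX : Set (Set (Z7 → ℂ)) := {{trivChar Z7}, Irr Z7 \ {trivChar Z7}}

/-- The class partition of the trivial supercharacter theory `M(Z₇)`. -/
def MK : Set (Set (ConjClasses Z7)) :=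
  {{ConjClasses.mk (1 : Z7)}, Set.univ \ {ConjClasses.mk (1 : Z7)}}

/-- The standard primitive additive character of `ZMod 7`. -/
noncomputable def eChar (j : ZMod 7) : ℂ := ZMod.stdAddChar j

/-- The irreducible characters of `Z7`. -/
noncomputable def chi (j : ZMod 7) : Z7 → ℂ := fun g => eChar (j * g.toAdd)

/-- The conjugacy classes of `Z7`. -/
def kap (j : ZMod 7) : ConjClasses Z7 := ConjClasses.mk (Multiplicative.ofAdd j)

lemma eChar_add (a b : ZMod 7) : eChar (a + b) = eChar a * eChar b :=
  AddChar.map_add_eq_mul _ _ _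

lemma eChar_zero : eChar 0 = 1 := AddChar.map_zero_eq_one _

lemma eChar_inj : Function.Injective eChar := ZMod.injective_stdAddChar

lemma eChar_pow (a : ZMod 7) (n : ℕ) : eChar (n * a) = eChar a ^ n := by
  rw [← nsmul_eq_mul]; exact AddChar.map_nsmul_eq_pow _ _ _

lemma chi_one (j : ZMod 7) : chi j 1 = 1 := by
  simp [chi, eChar_zero]

lemma chi_inj : Function.Injective chi := by
  intro a b h
  have := congrFun h (Multiplicative.ofAdd 1)
  simp only [chi, toAdd_ofAdd, mul_one] at this
  exact eChar_inj this

lemma kap_bij : Function.Bijective kap := by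
  refine ⟨fun a b h => ?_, fun c => ?_⟩
  · have := ConjClasses.mk_eq_mk_iff_isConj.1 h
    exact Multiplicative.ofAdd.injective (isConj_iff_eq.1 this)
  · obtain ⟨g, rfl⟩ := ConjClasses.mk_surjective c
    exact ⟨g.toAdd, rfl⟩

lemma eChar_prim : IsPrimitiveRoot (eChar 1) 7 := by
  have h := Complex.isPrimitiveRoot_exp 7 (by norm_num)
  have : eChar 1 = Complex.exp (2 * Real.pi * Complex.I / (7:ℕ)) := by
    have := ZMod.stdAddChar_coe (N := 7) 1
    simpa [eChar] using this
  rwa [this]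

lemma chi_mem_Irr (j : ZMod 7) : chi j ∈ Irr Z7 := by
  let ρ : Representation ℂ Z7 ℂ :=
    { toFun := fun g => chi j g • LinearMap.id
      map_one' := by rw [chi_one]; ext; simp
      map_mul' := fun a b => by
        ext; simp [chi, mul_add, eChar_add, mul_comm] }
  have hc : (FDRep.of ρ).character = chi j := by
    funext g
    change LinearMap.trace ℂ ℂ (chi j g • LinearMap.id) = _
    simp
  refine ⟨FDRep.of ρ, ?_, hc⟩
  rw [FDRep.simple_iff_char_is_norm_one, hc]
  have : ∀ g : Z7, chi j g * chi j g⁻¹ = 1 := by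
    intro g
    simp only [chi, toAdd_inv, ← eChar_add]
    simp [eChar_zero]
  simp [this]

lemma Irr_sub (f : Z7 → ℂ) (hf : f ∈ Irr Z7) : ∃ j, chi j = f := by
  obtain ⟨V, hV, rfl⟩ := hf
  have h1 : Module.finrank ℂ (V ⟶ V) = 1 := CategoryTheory.finrank_endomorphism_simple_eq_one ℂ V
  have hs : ∀ g : Z7, ∃ c : ℂ, V.ρ g = c • LinearMap.id := by
    intro g
    let F : V ⟶ V := ⟨CategoryTheory.InducedCategory.homMk (ModuleCat.ofHom (V.ρ g)), fun h => by
      ext x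
      change V.ρ g (V.ρ h x) = V.ρ h (V.ρ g x)
      rw [← Module.End.mul_apply, ← Module.End.mul_apply, ← map_mul, ← map_mul, mul_comm]⟩
    obtain ⟨c, hc⟩ := (finrank_eq_one_iff_of_nonzero' _ (CategoryTheory.id_nonzero V)).1 h1 F
    refine ⟨c, ?_⟩
    have := congrArg (fun f : V ⟶ V => f.hom.hom.hom) hc
    exact this.symm
  choose c hc using hs
  have hchar : ∀ g, V.character g = c g * Module.finrank ℂ V := by
    intro g
    change LinearMap.trace ℂ V (V.ρ g) = _
    rw [hc]; simp
  have hn := (FDRep.simple_iff_char_is_norm_one V).1 hV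
  have hone : V.character 1 = Module.finrank ℂ V := by
    change LinearMap.trace ℂ V (V.ρ 1) = _
    simp
  have hd0 : (Module.finrank ℂ V : ℂ) ≠ 0 := by
    intro h0
    simp [hchar, h0] at hn
  have hnt : Nontrivial V := by
    apply Module.nontrivial_of_finrank_pos (R := ℂ)
    exact Nat.pos_of_ne_zero (by exact_mod_cast hd0)
  have hmul : ∀ g h, c (g * h) = c g * c h := by
    intro g h
    obtain ⟨v, hv⟩ := exists_ne (0 : V)
    have : V.ρ (g * h) v = V.ρ g (V.ρ h v) := by rw [map_mul]; rfl
    simp only [hc, LinearMap.smul_apply, LinearMap.id_apply, smul_smul] at this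
    exact smul_left_injective ℂ hv this
  have hc1 : c 1 = 1 := by
    have := hchar 1
    rw [hone] at this
    exact mul_right_cancel₀ hd0 (by rw [one_mul]; exact this.symm)
  have hd : (Module.finrank ℂ V : ℂ) = 1 := by
    have : ∀ g, V.character g * V.character g⁻¹ = (Module.finrank ℂ V : ℂ) ^ 2 := by
      intro g
      have : c g * c g⁻¹ = 1 := by rw [← hmul, mul_inv_cancel, hc1]
      rw [hchar, hchar]; linear_combination (Module.finrank ℂ V : ℂ) ^ 2 * this
    simp only [this] at hn
    simp at hn
    have h2 : Module.finrank ℂ V = 1 ∨ False := by exact_mod_cast hn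
    rcases h2 with h2 | h2
    · rw [h2]; simp
    · exact h2.elim
  have hpow : ∀ (g : Z7) (n : ℕ), c (g ^ n) = c g ^ n := by
    intro g n
    induction n with
    | zero => simp [hc1]
    | succ n ih => rw [pow_succ, hmul, ih, pow_succ]
  have h7 : c (Multiplicative.ofAdd 1) ^ 7 = 1 := by
    rw [← hpow, ← hc1]; congr 1
  obtain ⟨i, hi, he⟩ := eChar_prim.eq_pow_of_pow_eq_one h7
  refine ⟨(i : ZMod 7), ?_⟩
  funext g
  rw [hchar, hd, mul_one]
  have hg : g = (Multiplicative.ofAdd (1 : ZMod 7)) ^ (g.toAdd.val) := by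
    rw [← ofAdd_nsmul]; simp
  conv_rhs => rw [hg, hpow, ← he, ← pow_mul, mul_comm, pow_mul, ← eChar_pow, ← eChar_pow]
  simp [chi, mul_comm]

lemma Irr_eq : Irr Z7 = Set.range chi :=
  Set.Subset.antisymm (fun f hf => Irr_sub f hf) (by rintro _ ⟨j, rfl⟩; exact chi_mem_Irr j)

lemma fact7 : Fact (Nat.Prime 7) := ⟨by norm_num⟩

lemma lin_indep (a : ZMod 7 → ℚ) (h : ∑ k, (a k : ℂ) * eChar k = 0) : ∀ k, a k = a 6 := by
  have hp := eChar_prim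
  have hgs := hp.geom_sum_eq_zero (by norm_num)
  have hv : ∀ n : ℕ, eChar (n : ZMod 7) = eChar 1 ^ n := by
    intro n; rw [← eChar_pow, mul_one]
  have h' : ∑ k : Fin 7, ((a (k.val : ZMod 7) : ℚ) : ℂ) * eChar 1 ^ k.val = 0 := by
    rw [← h]
    refine Finset.sum_congr rfl (fun k _ => ?_)
    have : ((k.val : ℕ) : ZMod 7) = k := ZMod.natCast_zmod_val (n := 7) k
    rw [← hv, this]
  rw [Finset.sum_fin_eq_sum_range] at h'
  simp [Finset.sum_range_succ] at h' hgs
  let q : Polynomial ℚ := ∑ i ∈ Finset.range 6, Polynomial.C (a (i : ZMod 7) - a 6) * Polynomial.X ^ i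
  have hq : Polynomial.aeval (eChar 1) q = 0 := by
    simp [q, Finset.sum_range_succ]
    linear_combination h' - (a 6 : ℂ) * hgs
  have hdeg : (minpoly ℚ (eChar 1)).natDegree = 6 := by
    rw [← Polynomial.cyclotomic_eq_minpoly_rat hp (by norm_num), Polynomial.natDegree_cyclotomic]
    decide
  have hq0 : q = 0 := by
    by_contra hne
    have h1 := Polynomial.natDegree_le_natDegree (minpoly.degree_le_of_ne_zero ℚ (eChar 1) hne hq)
    have h2 : q.natDegree ≤ 5 := by
      apply Polynomial.natDegree_sum_le_of_forall_le
      intro i hi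
      refine (Polynomial.natDegree_C_mul_X_pow_le _ _).trans ?_
      have := Finset.mem_range.1 hi
      omega
    omega
  have hco : ∀ i : ℕ, i < 6 → a (i : ZMod 7) = a 6 := by
    intro i hi
    have := congrArg (fun p => Polynomial.coeff p i) hq0
    simp only [q, Polynomial.finsetSum_coeff, Polynomial.coeff_C_mul_X_pow] at this
    simp at this
    have := this hi
    linarith
  intro k
  by_cases hk : k = 6
  · rw [hk]
  · have := hco k.val (by revert hk; revert k; decide)
    simpa using this

open Classical in
lemma sigma_chi (A : Set (ZMod 7)) (x : ZMod 7) :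
    sigmaCF (chi '' A) (Multiplicative.ofAdd x) = ∑ k, if k ∈ A then eChar (k * x) else 0 := by
  unfold sigmaCF
  rw [finsum_mem_image (chi_inj.injOn), finsum_mem_def, finsum_eq_sum_of_fintype]
  refine Finset.sum_congr rfl (fun k _ => ?_)
  simp only [Set.indicator, chi_one, one_mul]
  rfl

open Classical in
lemma sigma_chi' (A : Set (ZMod 7)) (x : ZMod 7) (hx : x ≠ 0) :
    sigmaCF (chi '' A) (Multiplicative.ofAdd x) =
      ∑ k, if k * x⁻¹ ∈ A then eChar k else 0 := by
  haveI := fact7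
  rw [sigma_chi]
  refine Fintype.sum_equiv (Equiv.mulRight₀ x hx) _ _ (fun k => ?_)
  simp [hx]

lemma sigma_iff (A : Set (ZMod 7)) (x y : ZMod 7) (hx : x ≠ 0) (hy : y ≠ 0) :
    sigmaCF (chi '' A) (Multiplicative.ofAdd x) = sigmaCF (chi '' A) (Multiplicative.ofAdd y) ↔
      ∀ k, k * x⁻¹ ∈ A ↔ k * y⁻¹ ∈ A := by
  haveI := fact7
  classical
  rw [sigma_chi' A x hx, sigma_chi' A y hy]
  refine ⟨fun h => ?_, fun h => by simp [h]⟩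
  have := lin_indep (fun k => (if k * x⁻¹ ∈ A then 1 else 0) - (if k * y⁻¹ ∈ A then 1 else 0)) (by
    rw [← sub_eq_zero, ← Finset.sum_sub_distrib] at h
    rw [← h]
    refine Finset.sum_congr rfl (fun k _ => ?_)
    push_cast
    split_ifs <;> simp)
  intro k
  have hk := (this k).trans (this 0).symm
  simp only [zero_mul, sub_self] at hk
  split_ifs at hk <;> simp_all

lemma refine_eq {α : Type} [Finite α] (P Q : Set (Set α))
    (hPn : ∀ A ∈ P, A.Nonempty) (hPd : P.Pairwise Disjoint)
    (hQu : ⋃₀ Q = Set.univ)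
    (hc : P.ncard = Q.ncard)
    (href : ∀ A ∈ P, ∀ S ∈ Q, ∀ x ∈ S, ∀ y ∈ S, x ∈ A → y ∈ A) : P = Q := by
  have hex : ∀ A : P, ∃ S ∈ Q, ∃ x ∈ S, x ∈ A.1 := by
    rintro ⟨A, hA⟩
    obtain ⟨x, hx⟩ := hPn A hA
    obtain ⟨S, hS, hxS⟩ : x ∈ ⋃₀ Q := hQu ▸ Set.mem_univ x
    exact ⟨S, hS, x, hxS, hx⟩
  choose g hgQ pt hpt hptA using hex
  have hsub : ∀ A : P, g A ⊆ A.1 := fun A y hy =>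
    href A.1 A.2 (g A) (hgQ A) (pt A) (hpt A) y hy (hptA A)
  have huniq : ∀ {R : Set (Set α)}, R.Pairwise Disjoint → ∀ {A B : Set α}, A ∈ R → B ∈ R →
      ∀ x, x ∈ A → x ∈ B → A = B := by
    intro R hR A B hA hB x hxA hxB
    by_contra hne
    exact Set.disjoint_left.1 (hR hA hB hne) hxA hxB
  have hinj : Function.Injective g := by
    intro A B h
    exact Subtype.ext (huniq hPd A.2 B.2 (pt A) (hptA A) (hsub B (h ▸ hpt A)))
  have hr : Set.range g = Q := by
    refine Set.eq_of_subset_of_ncard_le (by rintro _ ⟨A, rfl⟩; exact hgQ A) ?_ (Set.toFinite _)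
    rw [← hc, ← Set.image_univ, Set.ncard_image_of_injective _ hinj, Set.ncard_univ]
    rfl
  refine Set.eq_of_subset_of_ncard_le (fun A hA => ?_) hc.ge (Set.toFinite _)
  have : A = g ⟨A, hA⟩ := by
    refine Set.Subset.antisymm (fun x hx => ?_) (hsub _)
    obtain ⟨S, hS, hxS⟩ : x ∈ ⋃₀ Q := hQu ▸ Set.mem_univ x
    rw [← hr] at hS
    obtain ⟨B, rfl⟩ := hS
    have : B = ⟨A, hA⟩ := Subtype.ext (huniq hPd B.2 hA x (hsub B hxS) hx)
    rwa [this] at hxS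
  rw [this]; exact hgQ _

/-- The orbits of multiplication by `H`. -/
def orb (H : Set (ZMod 7)) : Set (Set (ZMod 7)) := Set.range (fun a => (fun h => a * h) '' H)

lemma four (H : Set (ZMod 7)) (h1 : 1 ∈ H) (h0 : 0 ∉ H) (hm : ∀ x ∈ H, ∀ y ∈ H, x * y ∈ H) :
    H = {1} ∨ H = {0}ᶜ ∨ H = {1, 2, 4} ∨ H = {1, 6} := by
  have key : ∀ F : Finset (ZMod 7), 1 ∈ F → 0 ∉ F → (∀ x ∈ F, ∀ y ∈ F, x * y ∈ F) →
     F = {1} ∨ F = {0}ᶜ ∨ F = {1, 2, 4} ∨ F = {1, 6} := by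
    decide +kernel
  classical
  have := key H.toFinset (by simpa) (by simpa) (by simpa using hm)
  simpa [← Finset.coe_inj] using this

lemma comb (P Q : Set (Set (ZMod 7)))
    (hPn : ∀ A ∈ P, A.Nonempty) (hPd : P.Pairwise Disjoint) (hPu : ⋃₀ P = Set.univ)
    (hQd : Q.Pairwise Disjoint) (hQu : ⋃₀ Q = Set.univ)
    (h0 : {0} ∈ Q) (hc : P.ncard = Q.ncard)
    (hcon : ∀ A ∈ P, ∀ S ∈ Q, ∀ x ∈ S, ∀ y ∈ S, x ≠ 0 → y ≠ 0 →
      ∀ k, k * x⁻¹ ∈ A ↔ k * y⁻¹ ∈ A) :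
    P = Q ∧ ∃ H : Set (ZMod 7), (1 ∈ H ∧ 0 ∉ H ∧ ∀ x ∈ H, ∀ y ∈ H, x * y ∈ H) ∧ P = orb H := by
  haveI := fact7
  have huniq : ∀ {R : Set (Set (ZMod 7))}, R.Pairwise Disjoint → ∀ {A B : Set (ZMod 7)},
      A ∈ R → B ∈ R → ∀ x, x ∈ A → x ∈ B → A = B := by
    intro R hR A B hA hB x hxA hxB
    by_contra hne
    exact Set.disjoint_left.1 (hR hA hB hne) hxA hxB
  have hz : ∀ S ∈ Q, 0 ∈ S → S = {0} := fun S hS h => huniq hQd hS h0 0 h rfl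
  have hPQ : P = Q := by
    refine refine_eq P Q hPn hPd hQu hc ?_
    intro A hA S hS x hx y hy hxA
    by_cases h : 0 ∈ S
    · rw [hz S hS h] at hx hy
      rw [hy, ← (show x = 0 from hx)]; exact hxA
    · have hx0 : x ≠ 0 := fun e => h (e ▸ hx)
      have hy0 : y ≠ 0 := fun e => h (e ▸ hy)
      have := (hcon A hA S hS x hx y hy hx0 hy0 (y * x)).2 (by field_simp; exact hxA)
      have e : y * x * x⁻¹ = y := by field_simp
      rwa [e] at this
  refine ⟨hPQ, ?_⟩
  subst hPQ
  obtain ⟨H, hH, h1⟩ : (1 : ZMod 7) ∈ ⋃₀ P := hPu ▸ Set.mem_univ _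
  have h0H : (0 : ZMod 7) ∉ H := by
    intro h
    rw [hz H hH h] at h1
    exact one_ne_zero h1
  have hblock : ∀ A ∈ P, ∀ a ∈ A, a ≠ 0 → A = (fun h => a * h) '' H := by
    intro A hA a ha ha0
    have h0A : (0 : ZMod 7) ∉ A := by
      intro h
      rw [hz A hA h] at ha
      exact ha0 ha
    ext b
    constructor
    · intro hb
      have hb0 : b ≠ 0 := fun e => h0A (e ▸ hb)
      refine ⟨b * a⁻¹, ?_, by field_simp⟩
      refine (hcon H hH A hA a ha b hb ha0 hb0 b).2 ?_
      rwa [mul_inv_cancel₀ hb0]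
    · rintro ⟨h, hh, rfl⟩
      have hh0 : h ≠ 0 := fun e => h0H (e ▸ hh)
      have := (hcon A hA H hH h hh 1 h1 hh0 one_ne_zero (a * h)).1 (by
        rwa [mul_assoc, mul_inv_cancel₀ hh0, mul_one])
      simpa using this
  refine ⟨H, ⟨h1, h0H, ?_⟩, ?_⟩
  · intro x hx y hy
    have hx0 : x ≠ 0 := fun e => h0H (e ▸ hx)
    have := hblock H hH x hx hx0
    rw [this]
    exact ⟨y, hy, rfl⟩
  · have hz' : (fun h : ZMod 7 => 0 * h) '' H = {0} := by
      ext b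
      simp only [zero_mul, Set.mem_image, Set.mem_singleton_iff]
      exact ⟨fun ⟨_, _, h⟩ => h.symm, fun h => ⟨1, h1, h.symm⟩⟩
    ext A
    constructor
    · intro hA
      obtain ⟨a, ha⟩ := hPn A hA
      by_cases ha0 : a = 0
      · exact ⟨0, by rw [hz A hA (ha0 ▸ ha)]; exact hz'⟩
      · exact ⟨a, (hblock A hA a ha ha0).symm⟩
    · rintro ⟨a, rfl⟩
      by_cases ha0 : a = 0
      · subst ha0
        change (fun h : ZMod 7 => 0 * h) '' H ∈ P
        rw [hz']; exact h0
      · obtain ⟨A, hA, ha⟩ : a ∈ ⋃₀ P := hPu ▸ Set.mem_univ _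
        change (fun h : ZMod 7 => a * h) '' H ∈ P
        rw [← hblock A hA a ha ha0]; exact hA

/-- Multiplicatively closed sets of nonzero residues containing `1`. -/
def Hok (H : Set (ZMod 7)) : Prop := 1 ∈ H ∧ 0 ∉ H ∧ ∀ x ∈ H, ∀ y ∈ H, x * y ∈ H

/-- Transport of a partition to characters. -/
noncomputable def TX (P : Set (Set (ZMod 7))) : Set (Set (Z7 → ℂ)) := (fun A => chi '' A) '' P

/-- Transport of a partition to classes. -/
def TK (P : Set (Set (ZMod 7))) : Set (Set (ConjClasses Z7)) := (fun A => kap '' A) '' P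

lemma TX_inj : Function.Injective TX := (chi_inj.image_injective).image_injective
lemma TK_inj : Function.Injective TK := (kap_bij.1.image_injective).image_injective

lemma Hok.inv {H : Set (ZMod 7)} (h : Hok H) {x : ZMod 7} (hx : x ∈ H) : x⁻¹ ∈ H := by
  haveI := fact7
  have hx0 : x ≠ 0 := fun e => h.2.1 (e ▸ hx)
  have h6 : x ^ 6 = 1 := ZMod.pow_card_sub_one_eq_one (p := 7) hx0
  have : x⁻¹ = x * x * x * x * x := by
    apply inv_eq_of_mul_eq_one_right
    rw [← h6]; ring
  rw [this]
  exact h.2.2 _ (h.2.2 _ (h.2.2 _ (h.2.2 _ hx _ hx) _ hx) _ hx) _ hx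

lemma mem_smul {H : Set (ZMod 7)} (a b : ZMod 7) (ha : a ≠ 0) :
    b ∈ (fun h => a * h) '' H ↔ b * a⁻¹ ∈ H := by
  haveI := fact7
  constructor
  · rintro ⟨h, hh, rfl⟩
    have : a * h * a⁻¹ = h := by field_simp
    simpa only [this] using hh
  · intro h
    exact ⟨_, h, by field_simp⟩

lemma zero_smul' {H : Set (ZMod 7)} (h : Hok H) : (fun h : ZMod 7 => 0 * h) '' H = {0} := by
  ext b
  simp only [zero_mul, Set.mem_image, Set.mem_singleton_iff]
  exact ⟨fun ⟨_, _, h⟩ => h.symm, fun e => ⟨1, h.1, e.symm⟩⟩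

lemma orb_uniq {H : Set (ZMod 7)} (h : Hok H) {A : Set (ZMod 7)} (hA : A ∈ orb H)
    {a : ZMod 7} (ha : a ∈ A) : A = (fun h => a * h) '' H := by
  haveI := fact7
  obtain ⟨b, rfl⟩ := hA
  obtain ⟨c, hc, rfl⟩ := ha
  have hc0 : c ≠ 0 := fun e => h.2.1 (e ▸ hc)
  ext z
  constructor
  · rintro ⟨d, hd, rfl⟩
    exact ⟨d * c⁻¹, h.2.2 _ hd _ (h.inv hc), by simp only []; field_simp⟩
  · rintro ⟨d, hd, rfl⟩
    exact ⟨c * d, h.2.2 _ hc _ hd, by simp only []; ring⟩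

lemma self_mem {H : Set (ZMod 7)} (h : Hok H) (a : ZMod 7) : a ∈ (fun h => a * h) '' H :=
  ⟨1, h.1, mul_one a⟩

lemma sigma_con {H : Set (ZMod 7)} (h : Hok H) {A S : Set (ZMod 7)} (hA : A ∈ orb H)
    (hS : S ∈ orb H) {x y : ZMod 7} (hx : x ∈ S) (hy : y ∈ S) :
    sigmaCF (chi '' A) (Multiplicative.ofAdd x) = sigmaCF (chi '' A) (Multiplicative.ofAdd y) := by
  haveI := fact7
  have hS' := orb_uniq h hS hx
  by_cases hx0 : x = 0
  · subst hx0
    rw [zero_smul' h] at hS'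
    rw [hS'] at hy
    rw [show y = 0 from hy]
  rw [hS'] at hy
  obtain ⟨c, hc, rfl⟩ := hy
  have hc0 : c ≠ 0 := fun e => h.2.1 (e ▸ hc)
  rw [sigma_iff _ _ _ hx0 (mul_ne_zero hx0 hc0)]
  obtain ⟨b, rfl⟩ := hA
  intro k
  constructor
  · rintro ⟨d, hd, e⟩
    refine ⟨d * c⁻¹, h.2.2 _ hd _ (h.inv hc), ?_⟩
    simp only [] at e ⊢
    rw [← mul_assoc, e, mul_inv, mul_assoc]
  · rintro ⟨d, hd, e⟩
    refine ⟨d * c, h.2.2 _ hd _ hc, ?_⟩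
    simp only [] at e ⊢
    rw [← mul_assoc, e]; field_simp

lemma pairwise_image {α β : Type} {f : α → β} (hf : Function.Injective f) {P : Set (Set α)}
    (hP : P.Pairwise Disjoint) : ((fun A => f '' A) '' P).Pairwise Disjoint := by
  rintro _ ⟨A, hA, rfl⟩ _ ⟨B, hB, rfl⟩ hne
  have : A ≠ B := fun e => hne (by rw [e])
  exact Set.disjoint_image_of_injective hf (hP hA hB this)

lemma orb_pairwise {H : Set (ZMod 7)} (h : Hok H) : (orb H).Pairwise Disjoint := by
  intro A hA B hB hne
  rw [Set.disjoint_left]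
  intro x hxA hxB
  exact hne ((orb_uniq h hA hxA).trans (orb_uniq h hB hxB).symm)

lemma orb_union {H : Set (ZMod 7)} (h : Hok H) : ⋃₀ orb H = Set.univ :=
  Set.eq_univ_of_forall fun a => ⟨_, ⟨a, rfl⟩, self_mem h a⟩

lemma sUnion_image' {α β : Type} (f : α → β) (P : Set (Set α)) :
    ⋃₀ ((fun A => f '' A) '' P) = f '' (⋃₀ P) := by
  rw [Set.image_sUnion]

lemma orb_sct {H : Set (ZMod 7)} (h : Hok H) : IsSCT Z7 (TX (orb H)) (TK (orb H)) where
  nonemptyX := by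
    rintro _ ⟨_, ⟨a, rfl⟩, rfl⟩
    exact ⟨_, _, self_mem h a, rfl⟩
  pairwiseX := pairwise_image chi_inj (orb_pairwise h)
  unionX := by
    unfold TX
    rw [sUnion_image', orb_union h, Irr_eq, Set.image_univ]
  nonemptyK := by
    rintro _ ⟨_, ⟨a, rfl⟩, rfl⟩
    exact ⟨_, _, self_mem h a, rfl⟩
  pairwiseK := pairwise_image kap_bij.1 (orb_pairwise h)
  unionK := by
    unfold TK
    rw [sUnion_image', orb_union h, Set.image_univ, kap_bij.2.range_eq]
  idClassMem := ⟨{0}, ⟨0, zero_smul' h⟩, by simp only [Set.image_singleton]; rfl⟩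
  cardEq := by
    unfold TX TK
    rw [Set.ncard_image_of_injective _ chi_inj.image_injective,
      Set.ncard_image_of_injective _ kap_bij.1.image_injective]
  consistentPairs := by
    rintro _ ⟨A, hA, rfl⟩ _ ⟨S, hS, rfl⟩ x y ⟨x', hx', ex⟩ ⟨y', hy', ey⟩
    have ex : x' = x.toAdd := kap_bij.1 ex
    have ey : y' = y.toAdd := kap_bij.1 ey
    subst ex ey
    exact sigma_con h hA hS hx' hy'

lemma sct_orb (X : Set (Set (Z7 → ℂ))) (K : Set (Set (ConjClasses Z7))) (h : IsSCT Z7 X K) :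
    ∃ H, Hok H ∧ X = TX (orb H) ∧ K = TK (orb H) := by
  have hX : X = TX {A | chi '' A ∈ X} := by
    ext A
    constructor
    · intro hA
      have : A ⊆ Set.range chi := by
        rw [← Irr_eq, ← h.unionX]; exact Set.subset_sUnion_of_mem hA
      obtain ⟨B, rfl⟩ := Set.subset_range_iff_exists_image_eq.1 this
      exact ⟨B, hA, rfl⟩
    · rintro ⟨B, hB, rfl⟩; exact hB
  have hK : K = TK {A | kap '' A ∈ K} := by
    ext A
    constructor
    · intro hA
      have : A ⊆ Set.range kap := by rw [kap_bij.2.range_eq]; exact Set.subset_univ _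
      obtain ⟨B, rfl⟩ := Set.subset_range_iff_exists_image_eq.1 this
      exact ⟨B, hA, rfl⟩
    · rintro ⟨B, hB, rfl⟩; exact hB
  have := comb {A | chi '' A ∈ X} {A | kap '' A ∈ K}
    (fun A hA => Set.image_nonempty.1 (h.nonemptyX _ hA))
    (fun A hA B hB hne => (Set.disjoint_image_iff chi_inj).1
      (h.pairwiseX hA hB (fun e => hne (chi_inj.image_injective e))))
    (by
      apply chi_inj.image_injective
      have := h.unionX
      rw [hX, TX, sUnion_image', Irr_eq, ← Set.image_univ] at this
      exact this)
    (fun A hA B hB hne => (Set.disjoint_image_iff kap_bij.1).1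
      (h.pairwiseK hA hB (fun e => hne (kap_bij.1.image_injective e))))
    (by
      apply kap_bij.1.image_injective
      have := h.unionK
      rw [hK, TK, sUnion_image', ← kap_bij.2.range_eq, ← Set.image_univ] at this
      exact this)
    (by
      change kap '' {0} ∈ K
      rw [Set.image_singleton]
      exact h.idClassMem)
    (by
      have := h.cardEq
      rw [hX, hK, TX, TK, Set.ncard_image_of_injective _ chi_inj.image_injective,
        Set.ncard_image_of_injective _ kap_bij.1.image_injective] at this
      exact this)
    (by
      intro A hA S hS x hx y hy hx0 hy0
      rw [← sigma_iff A x y hx0 hy0]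
      exact h.consistentPairs _ hA _ hS _ _ ⟨x, hx, rfl⟩ ⟨y, hy, rfl⟩)
  obtain ⟨hPQ, H, hH, hP⟩ := this
  refine ⟨H, hH, ?_, ?_⟩
  · rw [← hP]; exact hX
  · rw [← hP, hPQ]; exact hK

lemma Hok_iff (H : Set (ZMod 7)) :
    Hok H ↔ H = {1} ∨ H = {0}ᶜ ∨ H = {1, 2, 4} ∨ H = {1, 6} := by
  refine ⟨fun h => four H h.1 h.2.1 h.2.2, ?_⟩
  rintro (rfl | rfl | rfl | rfl) <;> simp only [Hok, Set.mem_singleton_iff, Set.mem_compl_iff,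
    Set.mem_insert_iff] <;> decide

lemma orb_inj {H1 H2 : Set (ZMod 7)} (h1 : Hok H1) (h2 : Hok H2) (h : orb H1 = orb H2) :
    H1 = H2 := by
  have e : ∀ H : Set (ZMod 7), (fun h : ZMod 7 => 1 * h) '' H = H := by intro H; simp
  have hm : H1 ∈ orb H2 := h ▸ ⟨1, e H1⟩
  rw [orb_uniq h2 hm h1.1, e]

lemma chi_zero : chi 0 = trivChar Z7 := by
  funext g; simp [chi, trivChar, eChar_zero]

lemma TX_ncard {H : Set (ZMod 7)} (h : Hok H) (A) (hA : A ∈ TX (orb H))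
    (hne : A ≠ {trivChar Z7}) : A.ncard = H.ncard := by
  haveI := fact7
  obtain ⟨_, ⟨a, rfl⟩, rfl⟩ := hA
  by_cases ha : a = 0
  · subst ha
    exact absurd (by simp only [zero_smul' h, Set.image_singleton, chi_zero]) hne
  · simp only []
    rw [Set.ncard_image_of_injective _ chi_inj,
      Set.ncard_image_of_injective _ (mul_right_injective₀ ha)]

lemma TK_ncard {H : Set (ZMod 7)} (h : Hok H) (A) (hA : A ∈ TK (orb H))
    (hne : A ≠ {ConjClasses.mk (1 : Z7)}) : A.ncard = H.ncard := by
  haveI := fact7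
  obtain ⟨_, ⟨a, rfl⟩, rfl⟩ := hA
  by_cases ha : a = 0
  · subst ha
    exact absurd (by simp only [zero_smul' h, Set.image_singleton]; rfl) hne
  · simp only []
    rw [Set.ncard_image_of_injective _ kap_bij.1,
      Set.ncard_image_of_injective _ (mul_right_injective₀ ha)]

lemma orb_one : orb {1} = Set.range (fun a : ZMod 7 => ({a} : Set (ZMod 7))) := by
  simp [orb]

lemma orb_all : orb {0}ᶜ = {{0}, {0}ᶜ} := by
  haveI := fact7
  have hk : Hok {0}ᶜ := (Hok_iff _).2 (by simp)
  have e : ∀ a : ZMod 7, a ≠ 0 → (fun h : ZMod 7 => a * h) '' {0}ᶜ = {0}ᶜ := by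
    intro a ha
    ext b
    rw [mem_smul a b ha]
    simp [ha]
  ext A
  simp only [Set.mem_insert_iff, Set.mem_singleton_iff]
  constructor
  · rintro ⟨a, rfl⟩
    by_cases ha : a = 0
    · left; subst ha; exact zero_smul' hk
    · right; exact e a ha
  · rintro (rfl | rfl)
    · exact ⟨0, zero_smul' hk⟩
    · exact ⟨1, e 1 one_ne_zero⟩

lemma mX_eq : mX = TX (orb {1}) := by
  ext A
  simp only [mX, TX, orb_one, Irr_eq, Set.mem_ofPred_eq, Set.mem_image, Set.mem_range]
  constructor
  · rintro ⟨_, ⟨j, rfl⟩, rfl⟩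
    exact ⟨{j}, ⟨j, rfl⟩, by simp⟩
  · rintro ⟨_, ⟨j, rfl⟩, rfl⟩
    exact ⟨chi j, ⟨j, rfl⟩, by simp⟩

lemma mK_eq : mK = TK (orb {1}) := by
  ext A
  simp only [mK, TK, orb_one, Set.mem_ofPred_eq, Set.mem_image, Set.mem_range]
  constructor
  · rintro ⟨k, rfl⟩
    obtain ⟨j, rfl⟩ := kap_bij.2 k
    exact ⟨{j}, ⟨j, rfl⟩, by simp⟩
  · rintro ⟨_, ⟨j, rfl⟩, rfl⟩
    exact ⟨kap j, by simp⟩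

lemma MX_eq : MX = TX (orb {0}ᶜ) := by
  rw [orb_all, TX, Set.image_pair, Set.image_singleton, chi_zero, MX, Set.compl_eq_univ_sdiff,
    Set.image_sdiff chi_inj, Set.image_univ, Set.image_singleton, chi_zero, Irr_eq]

lemma MK_eq : MK = TK (orb {0}ᶜ) := by
  have h0 : kap 0 = ConjClasses.mk (1 : Z7) := rfl
  rw [orb_all, TK, Set.image_pair, Set.image_singleton, h0, MK, Set.compl_eq_univ_sdiff,
    Set.image_sdiff kap_bij.1, Set.image_univ, Set.image_singleton, h0, kap_bij.2.range_eq]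

lemma theories_eq :
    {p : Set (Set (Z7 → ℂ)) × Set (Set (ConjClasses Z7)) | IsSCT Z7 p.1 p.2} =
      (fun H => (TX (orb H), TK (orb H))) '' {H | Hok H} := by
  ext ⟨X, K⟩
  constructor
  · intro h
    obtain ⟨H, hH, rfl, rfl⟩ := sct_orb X K h
    exact ⟨H, hH, rfl⟩
  · rintro ⟨H, hH, e⟩
    simp only [Prod.mk.injEq] at e
    obtain ⟨rfl, rfl⟩ := e
    exact orb_sct hH

lemma Hok_set : {H | Hok H} = ({{1}, {0}ᶜ, {1, 2, 4}, {1, 6}} : Set (Set (ZMod 7))) := by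
  ext H
  simp only [Set.mem_ofPred_eq, Hok_iff, Set.mem_insert_iff, Set.mem_singleton_iff]

lemma Hok_ncard : {H | Hok H}.ncard = 4 := by
  have : {H | Hok H} = (fun F : Finset (ZMod 7) => (F : Set (ZMod 7))) ''
      (({{1}, {0}ᶜ, {1, 2, 4}, {1, 6}} : Finset (Finset (ZMod 7))) : Set (Finset (ZMod 7))) := by
    rw [Hok_set]
    simp [Set.image_insert_eq]
  rw [this, Set.ncard_image_of_injective _ Finset.coe_injective, Set.ncard_coe_finset]
  decide

/-- `Z₇` has exactly four supercharacter theories: the two trivial ones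
`m(Z₇)`, `M(Z₇)`, one whose nontrivial parts (of characters and of classes) all have size 3,
and one whose nontrivial parts all have size 2. -/
theorem stmt_13 :
    ∃ (X3 X2 : Set (Set (Z7 → ℂ))) (K3 K2 : Set (Set (ConjClasses Z7))),
      {p : Set (Set (Z7 → ℂ)) × Set (Set (ConjClasses Z7)) | IsSCT Z7 p.1 p.2} =
        {(mX, mK), (MX, MK), (X3, K3), (X2, K2)} ∧
      {p : Set (Set (Z7 → ℂ)) × Set (Set (ConjClasses Z7)) | IsSCT Z7 p.1 p.2}.ncard = 4 ∧
      (∀ A ∈ X3, A ≠ {trivChar Z7} → A.ncard = 3) ∧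
      (∀ S ∈ K3, S ≠ {ConjClasses.mk (1 : Z7)} → S.ncard = 3) ∧
      (∀ A ∈ X2, A ≠ {trivChar Z7} → A.ncard = 2) ∧
      (∀ S ∈ K2, S ≠ {ConjClasses.mk (1 : Z7)} → S.ncard = 2) := by
  have h3 : Hok {1, 2, 4} := (Hok_iff _).2 (by simp)
  have h2 : Hok {1, 6} := (Hok_iff _).2 (by simp)
  have c3 : ({1, 2, 4} : Set (ZMod 7)).ncard = 3 := by
    rw [show ({1, 2, 4} : Set (ZMod 7)) = (({1, 2, 4} : Finset (ZMod 7)) : Set (ZMod 7)) by simp,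
      Set.ncard_coe_finset]
    decide
  have c2 : ({1, 6} : Set (ZMod 7)).ncard = 2 := by
    rw [show ({1, 6} : Set (ZMod 7)) = (({1, 6} : Finset (ZMod 7)) : Set (ZMod 7)) by simp,
      Set.ncard_coe_finset]
    decide
  refine ⟨TX (orb {1, 2, 4}), TX (orb {1, 6}), TK (orb {1, 2, 4}), TK (orb {1, 6}),
    ?_, ?_, ?_, ?_, ?_, ?_⟩
  · rw [theories_eq, Hok_set, mX_eq, mK_eq, MX_eq, MK_eq]
    simp only [Set.image_insert_eq, Set.image_singleton]
  · rw [theories_eq, Set.ncard_image_of_injOn, Hok_ncard]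
    intro H1 hH1 H2 hH2 e
    exact orb_inj hH1 hH2 (TX_inj (congrArg Prod.fst e))
  · intro A hA hne
    rw [TX_ncard h3 A hA hne, c3]
  · intro A hA hne
    rw [TK_ncard h3 A hA hne, c3]
  · intro A hA hne
    rw [TX_ncard h2 A hA hne, c2]
  · intro A hA hne
    rw [TK_ncard h2 A hA hne, c2]
end
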